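/- There exists ε₀ > 0, depending only on S and k, such that for every k-fission H of S within any ε ≤ ε₀ the following holds: for every halving edge {v,w} of S, there are exactly k halving edges of H traversing the v-cluster and the w-cluster. -/

import Mathlib

noncomputable section

/-- The plane. -/
abbrev Pt : Type := EuclideanSpace ℝ (Fin 2)

/-- Signed determinant of the triple `(p, q, r)`: positive iff `r` lies on the left of
the directed line from `p` to `q`. -/
def det2 (p q r : Pt) : ℝ :=
  (q 0 - p 0) * (r 1 - p 1) - (q 1 - p 1) * (r 0 - p 0)

/-- A finite set of points in the plane is in general position if no three of its
(distinct) points are collinear. -/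
def GenPos (S : Finset Pt) : Prop :=
  ∀ p ∈ S, ∀ q ∈ S, ∀ r ∈ S, p ≠ q → p ≠ r → q ≠ r →
    ¬ Collinear ℝ ({p, q, r} : Set Pt)

/-- `{p, q}` is a halving edge of `S`: `p, q` are distinct points of `S` and the open
half-planes on the two sides of the line through `p` and `q` each contain exactly
`(|S| - 2)/2` points of `S`. -/
def HalvingEdge (S : Finset Pt) (p q : Pt) : Prop :=
  p ∈ S ∧ q ∈ S ∧ p ≠ q ∧
    {r ∈ (S : Set Pt) | 0 < det2 p q r}.ncard = (S.card - 2) / 2 ∧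
    {r ∈ (S : Set Pt) | det2 p q r < 0}.ncard = (S.card - 2) / 2

/-- The halving edges graph of `S` (as a graph on the whole plane; all vertices
outside `S` are isolated). -/
def halvingGraph (S : Finset Pt) : SimpleGraph Pt :=
  SimpleGraph.fromRel (HalvingEdge S)

/-- The number of halving edges of `S`. -/
def halvingEdgeCount (S : Finset Pt) : ℕ :=
  {e : Sym2 Pt | ∃ p q, e = s(p, q) ∧ HalvingEdge S p q}.ncard

/-- `H`, together with the cluster map `cl`, is a `k`-fission of `S` within `ε`:
`H` is a set of `k * |S|` points in general position partitioned into clusters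
`cl v` of `k` points, one for each `v ∈ S`, with each point of the `v`-cluster
within distance `ε` of `v`. -/
structure IsFission (S : Finset Pt) (k : ℕ) (ε : ℝ) (H : Finset Pt)
    (cl : Pt → Finset Pt) : Prop where
  genPos : GenPos H
  cluster_card : ∀ v ∈ S, (cl v).card = k
  disj : ∀ v ∈ S, ∀ w ∈ S, v ≠ w → Disjoint (cl v) (cl w)
  union_eq : (H : Set Pt) = ⋃ v ∈ S, (cl v : Set Pt)
  close : ∀ v ∈ S, ∀ x ∈ cl v, dist x v ≤ ε

/-- A fission is plain if no halving edge of `H` has both endpoints in the same cluster. -/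
def IsPlain (S : Finset Pt) (H : Finset Pt) (cl : Pt → Finset Pt) : Prop :=
  ∀ v ∈ S, ∀ p ∈ cl v, ∀ q ∈ cl v, ¬ HalvingEdge H p q


local instance : DecidableEq Pt := Classical.decEq _

theorem mul_neg_iff_of_pos_left_real {a b : ℝ} (ha : 0 < a) : a * b < 0 ↔ b < 0 :=
  smul_neg_iff_of_pos_left ha

/-- The continuous `m`-th order statistic (counting from `0`) of a finite family of
continuous real functions. -/
theorem exists_continuous_orderStat {α : Type*} (V : Finset α) (f : α → ℝ → ℝ)
    (hf : ∀ p, Continuous (f p)) (m : ℕ) (hm : m < V.card) :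
    ∃ g : ℝ → ℝ, Continuous g ∧ ∀ x,
      m < (V.filter fun p => f p x ≤ g x).card ∧ (V.filter fun p => f p x < g x).card ≤ m := by
  classical
  have hne : ∀ T : {T // T ∈ V.powersetCard (m + 1)}, T.1.Nonempty := fun T => by
    have := (Finset.mem_powersetCard.1 T.2).2
    exact Finset.card_pos.1 (by omega)
  have hP : (V.powersetCard (m + 1)).attach.Nonempty := by
    rw [Finset.attach_nonempty_iff]
    exact Finset.powersetCard_nonempty.2 hm
  refine ⟨fun x => (V.powersetCard (m + 1)).attach.inf' hP
    (fun T => T.1.sup' (hne T) (fun p => f p x)), ?_, fun x => ⟨?_, ?_⟩⟩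
  · exact Continuous.finset_inf'_apply hP fun T _ =>
      Continuous.finset_sup'_apply (hne T) fun p _ => hf p
  · obtain ⟨T, -, hT⟩ := Finset.exists_mem_eq_inf' hP
      (fun T => T.1.sup' (hne T) (fun p => f p x))
    beta_reduce
    rw [hT]
    obtain ⟨hTV, hTc⟩ := Finset.mem_powersetCard.1 T.2
    have : T.1 ⊆ V.filter fun p => f p x ≤ T.1.sup' (hne T) (fun p => f p x) := fun p hp =>
      Finset.mem_filter.2 ⟨hTV hp, Finset.le_sup' (fun p => f p x) hp⟩
    have := Finset.card_le_card this
    omega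
  · by_contra! h
    obtain ⟨T, hTs, hTc⟩ := Finset.exists_subset_card_eq (Nat.succ_le_of_lt h)
    have hTV : T ∈ V.powersetCard (m + 1) :=
      Finset.mem_powersetCard.2 ⟨hTs.trans (Finset.filter_subset _ _), hTc⟩
    have h1 := Finset.inf'_le (fun T : {T // T ∈ V.powersetCard (m + 1)} =>
      T.1.sup' (hne T) (fun p => f p x)) (Finset.mem_attach _ ⟨T, hTV⟩)
    have h2 := (Finset.sup'_lt_iff (hne ⟨T, hTV⟩)).2
      fun p hp => (Finset.mem_filter.1 (hTs hp)).2
    exact absurd h1 (not_le.2 h2)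

/-- Levels of two families of continuous functions meet if one family passes from being
below the other to being above it. -/
theorem exists_level_crossing {α : Type*} (V W : Finset α) (f : α → ℝ → ℝ)
    (hf : ∀ p, Continuous (f p)) (a b : ℕ) (ha : a < V.card) (hb : b < W.card) (x₀ x₁ : ℝ)
    (h₀ : ∀ p ∈ V, ∀ q ∈ W, f p x₀ ≤ f q x₀) (h₁ : ∀ p ∈ V, ∀ q ∈ W, f q x₁ ≤ f p x₁) :
    ∃ x y, (a < (V.filter fun p => f p x ≤ y).card ∧ (V.filter fun p => f p x < y).card ≤ a) ∧
      (b < (W.filter fun p => f p x ≤ y).card ∧ (W.filter fun p => f p x < y).card ≤ b) := by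
  have key : ∀ (A B : Finset α) (m l : ℕ), l < B.card → ∀ s t x,
      m < (A.filter fun p => f p x ≤ s).card → (B.filter fun p => f p x < t).card ≤ l →
      (∀ p ∈ A, ∀ q ∈ B, f q x ≤ f p x) → t ≤ s := by
    intro A B m l hl s t x hA hB hAB
    obtain ⟨p, hp⟩ := Finset.card_pos.1 (by omega : 0 < (A.filter fun p => f p x ≤ s).card)
    obtain ⟨hpA, hps⟩ := Finset.mem_filter.1 hp
    obtain ⟨q, hqB, hq⟩ : ∃ q ∈ B, t ≤ f q x := by
      by_contra! h
      rw [Finset.filter_true_of_mem h] at hB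
      omega
    exact hq.trans ((hAB p hpA q hqB).trans hps)
  obtain ⟨g, hg, hgx⟩ := exists_continuous_orderStat V f hf a ha
  obtain ⟨h, hh, hhx⟩ := exists_continuous_orderStat W f hf b hb
  have e₁ := key V W a b hb _ _ x₁ (hgx x₁).1 (hhx x₁).2 h₁
  have e₀ := key W V b a ha _ _ x₀ (hhx x₀).1 (hgx x₀).2 fun q hq p hp => h₀ p hp q hq
  obtain ⟨x, hx⟩ := mem_range_of_exists_le_of_exists_ge (hg.sub hh)
    (⟨x₀, sub_nonpos.2 e₀⟩ : ∃ x, (g - h) x ≤ 0) ⟨x₁, sub_nonneg.2 e₁⟩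
  have hx' : g x = h x := sub_eq_zero.1 hx
  exact ⟨x, g x, hgx x, hx' ▸ hhx x⟩

theorem exists_le_and_le_of_card_filter_lt_eq {α : Type*} (V : Finset α) (F F' : α → ℝ)
    (y y' : ℝ) {p : α} (hp : p ∈ V) (hpy : F' p = y')
    (h : (V.filter fun r => F r < y).card = (V.filter fun r => F' r < y').card) :
    ∃ r ∈ V, F' r ≤ y' ∧ y ≤ F r := by
  by_contra! hc
  have h1 : (V.filter fun r => F' r < y') ⊂ V.filter fun r => F' r ≤ y' := by
    refine Finset.ssubset_iff_of_subset (Finset.monotone_filter_right V fun r _ hr => hr.le)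
      |>.2 ⟨p, Finset.mem_filter.2 ⟨hp, hpy.le⟩, fun hm => ?_⟩
    exact absurd (Finset.mem_filter.1 hm).2 (by simp [hpy])
  have h2 : (V.filter fun r => F' r ≤ y') ⊆ V.filter fun r => F r < y := fun r hr => by
    obtain ⟨hrV, hr⟩ := Finset.mem_filter.1 hr
    exact Finset.mem_filter.2 ⟨hrV, hc r hrV hr⟩
  have := Finset.card_lt_card h1
  have := Finset.card_le_card h2
  omega

/-- The orientation determinant of three points in the coordinates `(X, N)`. -/
def orientDet {α : Type*} (X N : α → ℝ) (p q r : α) : ℝ :=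
  (X q - X p) * (N r - N p) - (N q - N p) * (X r - X p)

theorem orientDet_eq {α : Type*} (X N : α → ℝ) (p q r : α) (x y : ℝ)
    (hp : N p - x * X p = y) (hq : N q - x * X q = y) :
    orientDet X N p q r = (X q - X p) * (N r - x * X r - y) := by
  have h1 : N p = y + x * X p := by linarith
  have h2 : N q = y + x * X q := by linarith
  unfold orientDet
  rw [h1, h2]
  ring

theorem exists_line_through {α : Type*} (X N : α → ℝ) (p q : α) (h : X p < X q) :
    ∃ x y, N p - x * X p = y ∧ N q - x * X q = y := by
  have : X q - X p ≠ 0 := by linarith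
  refine ⟨(N q - N p) / (X q - X p), _, rfl, ?_⟩
  field_simp
  ring

section Bisecting

variable {α : Type*} [DecidableEq α] (X N : α → ℝ) (V W : Finset α) (k : ℕ)

theorem card_orientDet_pos_add_neg (hV : V.card = k) (hW : W.card = k)
    (hXV : ∀ p ∈ V, X p < 0) (hXW : ∀ q ∈ W, 0 < X q)
    (hgp : ∀ p ∈ V, ∀ q ∈ W, ∀ r ∈ V ∪ W, r ≠ p → r ≠ q → orientDet X N p q r ≠ 0)
    {p q : α} (hp : p ∈ V) (hq : q ∈ W) :
    ((V ∪ W).filter fun r => 0 < orientDet X N p q r).card +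
      ((V ∪ W).filter fun r => orientDet X N p q r < 0).card + 2 = 2 * k := by
  have hdisj : Disjoint V W := Finset.disjoint_left.2 fun r h1 h2 =>
    absurd (hXV r h1) (not_lt.2 (hXW r h2).le)
  have hpq : p ≠ q := fun h => absurd (hXV p hp) (not_lt.2 (h ▸ hXW q hq).le)
  have hc : (V ∪ W).card = 2 * k := by
    rw [Finset.card_union_of_disjoint hdisj]
    omega
  have h1 := Finset.card_filter_add_card_filter_not (s := V ∪ W)
    (fun r => 0 < orientDet X N p q r)
  have h2 := Finset.card_filter_add_card_filter_not
    (s := (V ∪ W).filter fun r => ¬ 0 < orientDet X N p q r)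
    (fun r => orientDet X N p q r < 0)
  rw [Finset.filter_filter, Finset.filter_filter] at h2
  have h3 : (V ∪ W).filter (fun r => ¬ 0 < orientDet X N p q r ∧ orientDet X N p q r < 0)
      = (V ∪ W).filter fun r => orientDet X N p q r < 0 :=
    Finset.filter_congr fun r _ => ⟨fun h => h.2, fun h => ⟨h.le.not_gt, h⟩⟩
  have h4 : (V ∪ W).filter (fun r => ¬ 0 < orientDet X N p q r ∧ ¬ orientDet X N p q r < 0)
      = {p, q} := by
    ext r
    simp only [Finset.mem_filter, Finset.mem_insert, Finset.mem_singleton]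
    constructor
    · rintro ⟨hr, h5, h6⟩
      by_contra! h
      exact hgp p hp q hq r hr h.1 h.2 (le_antisymm (not_lt.1 h5) (not_lt.1 h6))
    · rintro (rfl | rfl)
      · simp [orientDet, hp]
      · have : orientDet X N p r r = 0 := by unfold orientDet; ring
        simp [this, hq]
  rw [h3, h4, Finset.card_pair hpq] at h2
  omega

/-- Two point sets of size `k` separated by a line, with union in general position, have
exactly `k` pairs spanning a line that bisects the union. -/
theorem card_bisecting_pairs (hV : V.card = k) (hW : W.card = k)
    (hXV : ∀ p ∈ V, X p < 0) (hXW : ∀ q ∈ W, 0 < X q)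
    (hgp : ∀ p ∈ V, ∀ q ∈ W, ∀ r ∈ V ∪ W, r ≠ p → r ≠ q → orientDet X N p q r ≠ 0) :
    ((V ×ˢ W).filter fun e =>
      ((V ∪ W).filter fun r => 0 < orientDet X N e.1 e.2 r).card = k - 1 ∧
      ((V ∪ W).filter fun r => orientDet X N e.1 e.2 r < 0).card = k - 1).card = k := by
  have hlt : ∀ p ∈ V, ∀ q ∈ W, X p < X q := fun p hp q hq => (hXV p hp).trans (hXW q hq)
  have hVW : ∀ p ∈ V, ∀ q ∈ W, p ≠ q := fun p hp q hq h => (hlt p hp q hq).ne (h ▸ rfl)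
  have hdisj : Disjoint V W := Finset.disjoint_left.2 fun r h1 h2 => hVW r h1 r h2 rfl
  have hsplit : ∀ p q, ((V ∪ W).filter fun r => orientDet X N p q r < 0).card =
      (V.filter fun r => orientDet X N p q r < 0).card +
      (W.filter fun r => orientDet X N p q r < 0).card := fun p q => by
    rw [Finset.filter_union,
      Finset.card_union_of_disjoint (Finset.disjoint_filter_filter hdisj)]
  have hneg : ∀ (A : Finset α), ∀ p ∈ V, ∀ q ∈ W, ∀ x y, N p - x * X p = y → N q - x * X q = y →
      (A.filter fun r => orientDet X N p q r < 0) = A.filter fun r => N r - x * X r < y := by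
    intro A p hp q hq x y h1 h2
    refine Finset.filter_congr fun r _ => ?_
    rw [orientDet_eq X N p q r x y h1 h2,
      mul_neg_iff_of_pos_left_real (sub_pos.2 (hlt p hp q hq)), sub_neg]
  have hzero : ∀ p ∈ V, ∀ q ∈ W, ∀ x y, N p - x * X p = y → N q - x * X q = y →
      ∀ r ∈ V ∪ W, N r - x * X r = y → r = p ∨ r = q := by
    intro p hp q hq x y h1 h2 r hr h3
    by_contra! h
    apply hgp p hp q hq r hr h.1 h.2
    rw [orientDet_eq X N p q r x y h1 h2, h3, sub_self, mul_zero]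
  have hpn := fun p q (hp : p ∈ V) (hq : q ∈ W) =>
    card_orientDet_pos_add_neg X N V W k hV hW hXV hXW hgp hp hq
  conv_rhs => rw [← Finset.card_range k]
  refine Finset.card_bij
    (fun e _ => (V.filter fun r => orientDet X N e.1 e.2 r < 0).card) ?_ ?_ ?_
  · rintro ⟨p, q⟩ he
    simp only [Finset.mem_filter, Finset.mem_product] at he
    obtain ⟨⟨hp, hq⟩, -, h2⟩ := he
    have := hsplit p q
    have := Finset.card_pos.2 ⟨p, hp⟩
    simp only [Finset.mem_range]
    omega
  · rintro ⟨p, q⟩ he ⟨p', q'⟩ he' hA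
    simp only [Finset.mem_filter, Finset.mem_product] at he he' hA
    obtain ⟨⟨hp, hq⟩, -, h2⟩ := he
    obtain ⟨⟨hp', hq'⟩, -, h2'⟩ := he'
    obtain ⟨x, y, hpl, hql⟩ := exists_line_through X N p q (hlt p hp q hq)
    obtain ⟨x', y', hpl', hql'⟩ := exists_line_through X N p' q' (hlt p' hp' q' hq')
    have hB : (W.filter fun r => orientDet X N p q r < 0).card =
        (W.filter fun r => orientDet X N p' q' r < 0).card := by
      have := hsplit p q
      have := hsplit p' q'
      omega
    rw [hneg V p hp q hq x y hpl hql, hneg V p' hp' q' hq' x' y' hpl' hql'] at hA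
    rw [hneg W p hp q hq x y hpl hql, hneg W p' hp' q' hq' x' y' hpl' hql'] at hB
    obtain ⟨r₁, hr₁, h11, h12⟩ := exists_le_and_le_of_card_filter_lt_eq V
      (fun r => N r - x * X r) (fun r => N r - x' * X r) y y' hp' hpl' hA
    obtain ⟨r₂, hr₂, h21, h22⟩ := exists_le_and_le_of_card_filter_lt_eq V
      (fun r => N r - x' * X r) (fun r => N r - x * X r) y' y hp hpl hA.symm
    obtain ⟨r₃, hr₃, h31, h32⟩ := exists_le_and_le_of_card_filter_lt_eq W
      (fun r => N r - x * X r) (fun r => N r - x' * X r) y y' hq' hql' hB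
    obtain ⟨r₄, hr₄, h41, h42⟩ := exists_le_and_le_of_card_filter_lt_eq W
      (fun r => N r - x' * X r) (fun r => N r - x * X r) y' y hq hql hB.symm
    have hxx : x = x' := by
      rcases lt_trichotomy x x' with h | h | h
      · have := mul_pos_of_neg_of_neg (sub_neg.2 h) (hXV r₁ hr₁)
        have := mul_neg_of_neg_of_pos (sub_neg.2 h) (hXW r₄ hr₄)
        nlinarith
      · exact h
      · have := mul_neg_of_pos_of_neg (sub_pos.2 h) (hXV r₂ hr₂)
        have := mul_pos (sub_pos.2 h) (hXW r₃ hr₃)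
        nlinarith
    subst hxx
    have hyy : y = y' := by linarith
    subst hyy
    have e1 := hzero p hp q hq x y hpl hql p' (Finset.mem_union_left _ hp') hpl'
    have e2 := hzero p hp q hq x y hpl hql q' (Finset.mem_union_right _ hq') hql'
    rw [e1.resolve_right (hVW p' hp' q hq), e2.resolve_left (hVW p hp q' hq').symm]
  · intro a ha
    have ha := Finset.mem_range.1 ha
    have hlim : ∀ᶠ x : ℝ in Filter.atTop, ∀ p ∈ V, ∀ q ∈ W,
        |N q - N p| ≤ x * (X q - X p) := by
      refine (Finset.eventually_all V).2 fun p hp => (Finset.eventually_all W).2 fun q hq => ?_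
      exact (Filter.tendsto_id.atTop_mul_const
        (sub_pos.2 (hlt p hp q hq))).eventually_ge_atTop _
    obtain ⟨M, hM⟩ := hlim.exists
    obtain ⟨x, y, ⟨hV1, hV2⟩, hW1, hW2⟩ := exists_level_crossing V W
      (fun r x => N r - x * X r) (fun r => by fun_prop) a (k - 1 - a) (by omega) (by omega)
      (-M) M
      (fun p hp q hq => by have := abs_le.1 (hM p hp q hq); linarith [this.1])
      (fun p hp q hq => by have := abs_le.1 (hM p hp q hq); linarith [this.2])
    have hon : ∀ (A : Finset α) (m : ℕ), m < (A.filter fun r => N r - x * X r ≤ y).card →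
        (A.filter fun r => N r - x * X r < y).card ≤ m → ∃ p ∈ A, N p - x * X p = y := by
      intro A m h1 h2
      by_contra! h
      rw [Finset.filter_congr fun r hr => (lt_iff_le_and_ne.trans
        (and_iff_left (h r hr)) : N r - x * X r < y ↔ _)] at h2
      omega
    obtain ⟨p, hp, hpl⟩ := hon V a hV1 hV2
    obtain ⟨q, hq, hql⟩ := hon W _ hW1 hW2
    have hins : ∀ (A : Finset α) (s : α), (∀ r ∈ A, N r - x * X r = y → r = s) →
        (A.filter fun r => N r - x * X r ≤ y).card ≤
          (A.filter fun r => N r - x * X r < y).card + 1 := by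
      intro A s h
      refine (Finset.card_le_card fun r hr => ?_).trans
        (Finset.card_insert_le s (A.filter fun r => N r - x * X r < y))
      obtain ⟨hrA, hr⟩ := Finset.mem_filter.1 hr
      rcases hr.lt_or_eq with hr | hr
      · exact Finset.mem_insert_of_mem (Finset.mem_filter.2 ⟨hrA, hr⟩)
      · exact h r hrA hr ▸ Finset.mem_insert_self _ _
    have i1 := hins V p fun r hr h => (hzero p hp q hq x y hpl hql r
      (Finset.mem_union_left _ hr) h).resolve_right (hVW r hr q hq)
    have i2 := hins W q fun r hr h => (hzero p hp q hq x y hpl hql r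
      (Finset.mem_union_right _ hr) h).resolve_left (hVW p hp r hr).symm
    have c1 := hsplit p q
    have c2 := hpn p q hp hq
    have c3 : (V.filter fun r => orientDet X N p q r < 0).card = a := by
      rw [hneg V p hp q hq x y hpl hql]
      omega
    have c4 : (W.filter fun r => orientDet X N p q r < 0).card = k - 1 - a := by
      rw [hneg W p hp q hq x y hpl hql]
      omega
    refine ⟨(p, q), Finset.mem_filter.2 ⟨Finset.mem_product.2 ⟨hp, hq⟩, ?_, ?_⟩, c3⟩
    · dsimp only
      omega
    · dsimp only
      omega

end Bisecting

theorem collinear_of_det2_eq_zero {p q r : Pt} (h : det2 p q r = 0) :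
    Collinear ℝ ({p, q, r} : Set Pt) := by
  by_cases hpq : p = q
  · subst hpq
    simpa using collinear_pair ℝ p r
  rw [collinear_iff_of_mem (p₀ := p) (by simp)]
  refine ⟨q - p, ?_⟩
  simp only [Set.mem_insert_iff, Set.mem_singleton_iff, forall_eq_or_imp, forall_eq]
  refine ⟨⟨0, by simp⟩, ⟨1, by simp⟩, ?_⟩
  unfold det2 at h
  by_cases h0 : q 0 - p 0 = 0
  · have h1 : q 1 - p 1 ≠ 0 := fun h1 => hpq (by
      ext i
      fin_cases i
      · exact (sub_eq_zero.1 h0).symm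
      · exact (sub_eq_zero.1 h1).symm)
    refine ⟨(r 1 - p 1) / (q 1 - p 1), ?_⟩
    ext i
    fin_cases i
    · simp
      field_simp
      linarith
    · simp
      field_simp
      ring
  · refine ⟨(r 0 - p 0) / (q 0 - p 0), ?_⟩
    ext i
    fin_cases i
    · simp
      field_simp
      ring
    · simp
      field_simp
      linarith

theorem det2_ne_zero_of_genPos {S : Finset Pt} (hS : GenPos S) {p q r : Pt} (hp : p ∈ S)
    (hq : q ∈ S) (hr : r ∈ S) (hpq : p ≠ q) (hpr : p ≠ r) (hqr : q ≠ r) : det2 p q r ≠ 0 :=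
  fun h => hS p hp q hq r hr hpq hpr hqr (collinear_of_det2_eq_zero h)

theorem continuous_det2 : Continuous fun t : Pt × Pt × Pt => det2 t.1 t.2.1 t.2.2 := by
  unfold det2
  fun_prop

theorem eventually_det2_pos {p q r : Pt} (h : 0 < det2 p q r) :
    ∀ᶠ ε : ℝ in nhdsWithin 0 (Set.Ioi 0), ∀ p' q' r', dist p' p ≤ ε → dist q' q ≤ ε →
      dist r' r ≤ ε → 0 < det2 p' q' r' := by
  have h1 : {t : Pt × Pt × Pt | 0 < det2 t.1 t.2.1 t.2.2} ∈ nhds (p, q, r) :=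
    (isOpen_lt continuous_const continuous_det2).mem_nhds h
  obtain ⟨δ, hδ, hb⟩ := Metric.mem_nhds_iff.1 h1
  filter_upwards [Ioo_mem_nhdsGT hδ] with ε hε p' q' r' hp hq hr
  exact hb (show (p', q', r') ∈ _ by
    simp only [Metric.mem_ball, Prod.dist_eq, max_lt_iff]
    exact ⟨hp.trans_lt hε.2, hq.trans_lt hε.2, hr.trans_lt hε.2⟩)

theorem det2_swap (p q r : Pt) : det2 q p r = -det2 p q r := by
  unfold det2
  ring

theorem eventually_det2_neg {p q r : Pt} (h : det2 p q r < 0) :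
    ∀ᶠ ε : ℝ in nhdsWithin 0 (Set.Ioi 0), ∀ p' q' r', dist p' p ≤ ε → dist q' q ≤ ε →
      dist r' r ≤ ε → det2 p' q' r' < 0 := by
  have h' : 0 < det2 q p r := by rw [det2_swap]; linarith
  filter_upwards [eventually_det2_pos h'] with ε hε p' q' r' hp hq hr
  have := hε q' p' r' hq hp hr
  rw [det2_swap] at this
  linarith

/-- Coordinate in the direction from `v` to `w`, vanishing at their midpoint. -/
def axisCoord (v w z : Pt) : ℝ :=
  (w 0 - v 0) * (2 * z 0 - v 0 - w 0) + (w 1 - v 1) * (2 * z 1 - v 1 - w 1)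

/-- Coordinate orthogonal to the direction from `v` to `w`. -/
def normalCoord (v w z : Pt) : ℝ :=
  (w 0 - v 0) * z 1 - (w 1 - v 1) * z 0

theorem orientDet_axisCoord_normalCoord (v w p q r : Pt) :
    orientDet (axisCoord v w) (normalCoord v w) p q r =
      2 * ((w 0 - v 0) ^ 2 + (w 1 - v 1) ^ 2) * det2 p q r := by
  unfold orientDet axisCoord normalCoord det2
  ring

theorem sq_add_sq_pos_of_ne {v w : Pt} (h : v ≠ w) :
    0 < (w 0 - v 0) ^ 2 + (w 1 - v 1) ^ 2 := by
  by_contra! hc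
  apply h
  ext i
  fin_cases i
  · show v 0 = w 0
    nlinarith [sq_nonneg (w 0 - v 0), sq_nonneg (w 1 - v 1)]
  · show v 1 = w 1
    nlinarith [sq_nonneg (w 0 - v 0), sq_nonneg (w 1 - v 1)]

theorem axisCoord_swap (v w z : Pt) : axisCoord w v z = -axisCoord v w z := by
  unfold axisCoord
  ring

theorem eventually_axisCoord_neg {v w : Pt} (h : v ≠ w) :
    ∀ᶠ ε : ℝ in nhdsWithin 0 (Set.Ioi 0), ∀ z, dist z v ≤ ε → axisCoord v w z < 0 := by
  have hc : Continuous (axisCoord v w) := by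
    unfold axisCoord
    fun_prop
  have hv : axisCoord v w v < 0 := by
    have := sq_add_sq_pos_of_ne h
    unfold axisCoord
    nlinarith
  obtain ⟨δ, hδ, hb⟩ := Metric.mem_nhds_iff.1 ((isOpen_lt hc continuous_const).mem_nhds hv)
  filter_upwards [Ioo_mem_nhdsGT hδ] with ε hε z hz
  exact hb (Metric.mem_ball.2 (hz.trans_lt hε.2))

/-- Counting the points of a fission with a property that is constant on all clusters but
those of `v` and `w`. -/
theorem IsFission.card_filter {S : Finset Pt} {k : ℕ} {ε : ℝ} {H : Finset Pt}
    {cl : Pt → Finset Pt} (hH : IsFission S k ε H cl) {v w : Pt} (hv : v ∈ S) (hw : w ∈ S)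
    (P Q : Pt → Prop) [DecidablePred P] [DecidablePred Q] (hQv : ¬ Q v) (hQw : ¬ Q w)
    (hPQ : ∀ s ∈ S, s ≠ v → s ≠ w → ∀ r ∈ cl s, (P r ↔ Q s)) :
    (H.filter P).card = (S.filter Q).card * k + ((cl v ∪ cl w).filter P).card := by
  have hHu : H = S.biUnion cl := by
    rw [← Finset.coe_inj, hH.union_eq, Finset.coe_biUnion]
    rfl
  have hsub : S.filter Q ⊆ S := Finset.filter_subset _ _
  have hdec : H.filter P = (S.filter Q).biUnion cl ∪ (cl v ∪ cl w).filter P := by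
    ext r
    simp only [hHu, Finset.mem_filter, Finset.mem_union, Finset.mem_biUnion]
    constructor
    · rintro ⟨⟨s, hs, hr⟩, hP⟩
      by_cases h1 : s = v
      · exact Or.inr ⟨Or.inl (h1 ▸ hr), hP⟩
      by_cases h2 : s = w
      · exact Or.inr ⟨Or.inr (h2 ▸ hr), hP⟩
      exact Or.inl ⟨s, ⟨hs, (hPQ s hs h1 h2 r hr).1 hP⟩, hr⟩
    · rintro (⟨s, ⟨hs, hQ⟩, hr⟩ | ⟨hr | hr, hP⟩)
      · exact ⟨⟨s, hs, hr⟩, (hPQ s hs (fun h => hQv (h ▸ hQ)) (fun h => hQw (h ▸ hQ)) r hr).2 hQ⟩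
      · exact ⟨⟨v, hv, hr⟩, hP⟩
      · exact ⟨⟨w, hw, hr⟩, hP⟩
  rw [hdec, Finset.card_union_of_disjoint, Finset.card_biUnion,
    Finset.sum_const_nat fun s hs => hH.cluster_card s (hsub hs)]
  · exact fun s hs t ht hst => hH.disj s (hsub hs) t (hsub ht) hst
  · refine Finset.disjoint_left.2 fun r h1 h2 => ?_
    obtain ⟨s, hs, hr⟩ := Finset.mem_biUnion.1 h1
    obtain ⟨hs, hQ⟩ := Finset.mem_filter.1 hs
    rcases Finset.mem_union.1 (Finset.mem_filter.1 h2).1 with h3 | h3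
    · exact Finset.disjoint_left.1
        (hH.disj s hs v hv fun h => hQv (h ▸ hQ)) hr h3
    · exact Finset.disjoint_left.1
        (hH.disj s hs w hw fun h => hQw (h ▸ hQ)) hr h3

theorem IsFission.card_eq {S : Finset Pt} {k : ℕ} {ε : ℝ} {H : Finset Pt}
    {cl : Pt → Finset Pt} (hH : IsFission S k ε H cl) : H.card = S.card * k := by
  have hHu : H = S.biUnion cl := by
    rw [← Finset.coe_inj, hH.union_eq, Finset.coe_biUnion]
    rfl
  rw [hHu, Finset.card_biUnion hH.disj, Finset.sum_const_nat hH.cluster_card]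

theorem ncard_sep_coe (S : Finset Pt) (P : Pt → Prop) [DecidablePred P] :
    {r ∈ (S : Set Pt) | P r}.ncard = (S.filter P).card := by
  rw [← Set.ncard_coe_finset, Finset.coe_filter]
  rfl

theorem stmt5 (S : Finset Pt) (hS : GenPos S) (hcard : Even S.card)
    (k : ℕ) (hk : 1 ≤ k) :
    ∃ ε₀ > 0, ∀ ε : ℝ, 0 < ε → ε ≤ ε₀ →
      ∀ (H : Finset Pt) (cl : Pt → Finset Pt), IsFission S k ε H cl →
        ∀ v ∈ S, ∀ w ∈ S, HalvingEdge S v w →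
          {e : Sym2 Pt | ∃ p ∈ cl v, ∃ q ∈ cl w, e = s(p, q) ∧ HalvingEdge H p q}.ncard
            = k := by
  classical
  have hev : ∀ᶠ ε : ℝ in nhdsWithin 0 (Set.Ioi 0), ∀ v ∈ S, ∀ w ∈ S, v ≠ w →
      (∀ z, dist z v ≤ ε → axisCoord v w z < 0) ∧
      ∀ s ∈ S, s ≠ v → s ≠ w → ∀ p q r, dist p v ≤ ε → dist q w ≤ ε → dist r s ≤ ε →
        (0 < det2 p q r ↔ 0 < det2 v w s) ∧ (det2 p q r < 0 ↔ det2 v w s < 0) := by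
    refine (Finset.eventually_all S).2 fun v hv => (Finset.eventually_all S).2 fun w hw => ?_
    by_cases hvw : v = w
    · exact Filter.Eventually.of_forall fun _ h => absurd hvw h
    refine Filter.Eventually.mono ((eventually_axisCoord_neg hvw).and
      ((Finset.eventually_all S).2 fun s hs => ?_)) fun _ h _ => h
    by_cases hsv : s = v
    · exact Filter.Eventually.of_forall fun _ h => absurd hsv h
    by_cases hsw : s = w
    · exact Filter.Eventually.of_forall fun _ _ h => absurd hsw h
    rcases (det2_ne_zero_of_genPos hS hv hw hs hvw (Ne.symm hsv) (Ne.symm hsw)).lt_or_gt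
      with h | h
    · filter_upwards [eventually_det2_neg h] with ε hε _ _ p q r hp hq hr
      have := hε p q r hp hq hr
      exact ⟨by simp [this.not_gt, h.not_gt], by simp [this, h]⟩
    · filter_upwards [eventually_det2_pos h] with ε hε _ _ p q r hp hq hr
      have := hε p q r hp hq hr
      exact ⟨by simp [this, h], by simp [this.not_gt, h.not_gt]⟩
  obtain ⟨ε₀, hε₀, hpos⟩ := (hev.and self_mem_nhdsWithin).exists
  refine ⟨ε₀, hpos, fun ε _ hε H cl hH v hv w hw hvw => ?_⟩
  obtain ⟨-, -, hne, hl, hr⟩ := hvw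
  have hcl : ∀ s ∈ S, ∀ z ∈ cl s, dist z s ≤ ε₀ := fun s hs z hz =>
    (hH.close s hs z hz).trans hε
  have hclH : ∀ s ∈ S, ∀ z ∈ cl s, z ∈ H := fun s hs z hz => by
    rw [← Finset.mem_coe, hH.union_eq]
    exact Set.mem_biUnion hs hz
  have hXV : ∀ p ∈ cl v, axisCoord v w p < 0 := fun p hp =>
    (hε₀ v hv w hw hne).1 p (hcl v hv p hp)
  have hXW : ∀ q ∈ cl w, 0 < axisCoord v w q := fun q hq => by
    have := (hε₀ w hw v hv hne.symm).1 q (hcl w hw q hq)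
    rw [axisCoord_swap] at this
    linarith
  have hpq : ∀ p ∈ cl v, ∀ q ∈ cl w, p ≠ q := fun p hp q hq h => by
    have := hXV p hp
    have := hXW q hq
    rw [h] at *
    linarith
  have hd : 0 < 2 * ((w 0 - v 0) ^ 2 + (w 1 - v 1) ^ 2) := by
    have := sq_add_sq_pos_of_ne hne
    linarith
  have hgp : ∀ p ∈ cl v, ∀ q ∈ cl w, ∀ r ∈ cl v ∪ cl w, r ≠ p → r ≠ q →
      orientDet (axisCoord v w) (normalCoord v w) p q r ≠ 0 := by
    intro p hp q hq r hr h1 h2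
    rw [orientDet_axisCoord_normalCoord]
    refine mul_ne_zero hd.ne' (det2_ne_zero_of_genPos hH.genPos (hclH v hv p hp)
      (hclH w hw q hq) ?_ (hpq p hp q hq) h1.symm h2.symm)
    rcases Finset.mem_union.1 hr with h | h
    · exact hclH v hv r h
    · exact hclH w hw r h
  have hmain := card_bisecting_pairs (axisCoord v w) (normalCoord v w) (cl v) (cl w) k
    (hH.cluster_card v hv) (hH.cluster_card w hw) hXV hXW hgp
  simp only [orientDet_axisCoord_normalCoord, mul_pos_iff_of_pos_left hd,
    mul_neg_iff_of_pos_left_real hd] at hmain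
  have hhalf : ∀ p ∈ cl v, ∀ q ∈ cl w, (HalvingEdge H p q ↔
      ((cl v ∪ cl w).filter fun r => 0 < det2 p q r).card = k - 1 ∧
      ((cl v ∪ cl w).filter fun r => det2 p q r < 0).card = k - 1) := by
    intro p hp q hq
    have hv0 : det2 v w v = 0 := by unfold det2; ring
    have hw0 : det2 v w w = 0 := by unfold det2; ring
    have hsign := fun s hs h1 h2 r hr => (hε₀ v hv w hw hne).2 s hs h1 h2 p q r
      (hcl v hv p hp) (hcl w hw q hq) (hcl s hs r hr)
    have c1 := hH.card_filter hv hw (fun r => 0 < det2 p q r) (fun s => 0 < det2 v w s)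
      (by simp [hv0]) (by simp [hw0]) fun s hs h1 h2 r hr => (hsign s hs h1 h2 r hr).1
    have c2 := hH.card_filter hv hw (fun r => det2 p q r < 0) (fun s => det2 v w s < 0)
      (by simp [hv0]) (by simp [hw0]) fun s hs h1 h2 r hr => (hsign s hs h1 h2 r hr).2
    rw [ncard_sep_coe] at hl hr
    obtain ⟨m, hm⟩ := hcard
    have hmpos : 0 < S.card := Finset.card_pos.2 ⟨v, hv⟩
    obtain ⟨n, rfl⟩ : ∃ n, m = n + 1 := ⟨m - 1, by omega⟩
    have hn : (S.card - 2) / 2 = n := by omega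
    have hHn : (H.card - 2) / 2 = n * k + (k - 1) := by
      rw [hH.card_eq, hm]
      have : (n + 1 + (n + 1)) * k = 2 * (n * k) + 2 * k := by ring
      omega
    rw [hl, hn] at c1
    rw [hr, hn] at c2
    unfold HalvingEdge
    rw [ncard_sep_coe, ncard_sep_coe, c1, c2, hHn]
    simp only [hclH v hv p hp, hclH w hw q hq, ne_eq, hpq p hp q hq, not_false_eq_true,
      true_and, Nat.add_left_cancel_iff]
  rw [← hmain, ← Set.ncard_coe_finset]
  symm
  refine Set.ncard_congr (fun e _ => s(e.1, e.2)) ?_ ?_ ?_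
  · rintro ⟨p, q⟩ he
    obtain ⟨he, h⟩ := Finset.mem_filter.1 (Finset.mem_coe.1 he)
    obtain ⟨hp, hq⟩ := Finset.mem_product.1 he
    exact ⟨p, hp, q, hq, rfl, (hhalf p hp q hq).2 h⟩
  · rintro ⟨p, q⟩ ⟨p', q'⟩ he he' h
    obtain ⟨hp, hq⟩ := Finset.mem_product.1 (Finset.mem_filter.1 (Finset.mem_coe.1 he)).1
    obtain ⟨hp', hq'⟩ := Finset.mem_product.1 (Finset.mem_filter.1 (Finset.mem_coe.1 he')).1
    rcases Sym2.eq_iff.1 h with ⟨h1, h2⟩ | ⟨h1, -⟩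
    · exact Prod.ext h1 h2
    · exact absurd h1 (hpq p hp q' hq')
  · rintro e ⟨p, hp, q, hq, rfl, h⟩
    exact ⟨(p, q), Finset.mem_coe.2 (Finset.mem_filter.2
      ⟨Finset.mem_product.2 ⟨hp, hq⟩, (hhalf p hp q hq).1 h⟩), rfl⟩

end
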